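/- Let ξ = exp(2πi/11), ν = (−1+i√11)/2, ℤ[ν] = {a + bν : a, b ∈ ℤ} ⊂ ℂ, for k ∈ ℤ let v_k = (ξ^k, ξ^{9k}, ξ^{3k}, ξ^{4k}, ξ^{5k}) ∈ ℂ⁵, and set u₁ = (v₀ − 3v₁ + 3v₂ − v₃)/(1+2ν) and u₂ = (v₁ − 3v₂ + 3v₃ − v₄)/(1+2ν). Define Λ₂ = ℤ[ν]u₁ + ℤ[ν]u₂ + ℤ[ν]v₀ + ℤ[ν]v₁ + ℤ[ν]v₂ ⊂ ℂ⁵ and the alternating form E(x,y) = Im((2/√11)·(x₁·conj(y₁) + … + x₅·conj(y₅))) on ℂ⁵. Then: (i) the ten vectors u₁, νu₁, u₂, νu₂, v₀, νv₀, v₁, νv₁, v₂, νv₂ are linearly independent over ℝ, so Λ₂ is a full lattice in ℂ⁵ ≅ ℝ¹⁰; (ii) E takes integer values on Λ₂ × Λ₂; (iii) the determinant of the 10×10 integer matrix (E(b_i, b_j)), where b₁,…,b₁₀ is the basis in (i), equals 1; (iv) Λ₂ is stable under the diagonal map M_τ = diag(ξ, ξ⁹, ξ³, ξ⁴, ξ⁵).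 -/

import Mathlib

/-- ξ = exp(2πi/11), a primitive 11th root of unity. -/
noncomputable def ξ : ℂ := Complex.exp (2 * Real.pi * Complex.I / 11)

/-- ν = (−1 + i√11)/2. -/
noncomputable def ν : ℂ := (-1 + Complex.I * Real.sqrt 11) / 2

/-- ℤ[ν] = {a + bν : a, b ∈ ℤ} ⊂ ℂ. -/
noncomputable def Zν : Set ℂ := {z | ∃ a b : ℤ, z = (a : ℂ) + (b : ℂ) * ν}

/-- v_k = (ξ^k, ξ^{9k}, ξ^{3k}, ξ^{4k}, ξ^{5k}) ∈ ℂ⁵. -/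
noncomputable def v (k : ℕ) : Fin 5 → ℂ := fun i => ξ ^ (k * ![1, 9, 3, 4, 5] i)

/-- u₁ = (v₀ − 3v₁ + 3v₂ − v₃)/(1+2ν). -/
noncomputable def u₁ : Fin 5 → ℂ :=
  (1 / (1 + 2 * ν)) • (v 0 - (3 : ℂ) • v 1 + (3 : ℂ) • v 2 - v 3)

/-- u₂ = (v₁ − 3v₂ + 3v₃ − v₄)/(1+2ν). -/
noncomputable def u₂ : Fin 5 → ℂ :=
  (1 / (1 + 2 * ν)) • (v 1 - (3 : ℂ) • v 2 + (3 : ℂ) • v 3 - v 4)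

/-- The ℤ[ν]-basis (u₁, u₂, v₀, v₁, v₂) of the period lattice Λ₂. -/
noncomputable def periodBasis : Fin 5 → (Fin 5 → ℂ) := ![u₁, u₂, v 0, v 1, v 2]

/-- The lattice Λ₂ = ℤ[ν]u₁ + ℤ[ν]u₂ + ℤ[ν]v₀ + ℤ[ν]v₁ + ℤ[ν]v₂ ⊂ ℂ⁵. -/
noncomputable def Λ₂ : Set (Fin 5 → ℂ) :=
  {x | ∃ c : Fin 5 → ℂ, (∀ j, c j ∈ Zν) ∧ x = ∑ j : Fin 5, c j • periodBasis j}

/-- The alternating form E(x,y) = Im((2/√11)·(x₁conj(y₁) + … + x₅conj(y₅))). -/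
noncomputable def E (x y : Fin 5 → ℂ) : ℝ :=
  ((2 / (Real.sqrt 11 : ℂ)) * ∑ i : Fin 5, x i * (starRingEnd ℂ) (y i)).im

/-- The ten vectors u₁, νu₁, u₂, νu₂, v₀, νv₀, v₁, νv₁, v₂, νv₂. -/
noncomputable def tenBasis : Fin 10 → (Fin 5 → ℂ) :=
  ![u₁, ν • u₁, u₂, ν • u₂, v 0, ν • v 0, v 1, ν • v 1, v 2, ν • v 2]

open Matrix QuadraticAlgebra

theorem ξ_pow_eleven : ξ ^ 11 = 1 := by
  rw [ξ, ← Complex.exp_nat_mul, ← Complex.exp_two_pi_mul_I]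
  congr 1
  push_cast
  ring

theorem isPrimitiveRoot_ξ : IsPrimitiveRoot ξ 11 := by
  simpa [ξ] using Complex.isPrimitiveRoot_exp 11 (by norm_num)

theorem conj_ξ : (starRingEnd ℂ) ξ = ξ ^ 10 := by
  have hξ : ‖ξ‖ = 1 := isPrimitiveRoot_ξ.norm'_eq_one (by norm_num)
  have h : ξ * (starRingEnd ℂ) ξ = 1 := by
    rw [Complex.mul_conj, Complex.normSq_eq_norm_sq, hξ]
    norm_num
  linear_combination (-(starRingEnd ℂ) ξ) * ξ_pow_eleven + ξ ^ 10 * h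

theorem geom_sum_ξ :
    1 + ξ + ξ ^ 2 + ξ ^ 3 + ξ ^ 4 + ξ ^ 5 + ξ ^ 6 + ξ ^ 7 + ξ ^ 8 + ξ ^ 9 + ξ ^ 10 = 0 := by
  simpa [Finset.sum_range_succ] using isPrimitiveRoot_ξ.geom_sum_eq_zero (by norm_num)

theorem sqrt_eleven_sq : (Real.sqrt 11 : ℂ) ^ 2 = 11 := by
  norm_cast
  norm_num

theorem ν_sq : ν ^ 2 = -3 - ν := by
  rw [ν]
  linear_combination (Complex.I ^ 2 / 4) * sqrt_eleven_sq + 11 / 4 * Complex.I_sq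

theorem im_ν : ν.im = Real.sqrt 11 / 2 := by
  simp [ν]

theorem conj_ν : (starRingEnd ℂ) ν = -1 - ν := by
  simp only [ν, map_div₀, map_add, map_neg, map_one, map_mul, Complex.conj_I, Complex.conj_ofReal,
    map_ofNat]
  ring

theorem one_div_one_add_two_mul_ν : 1 / (1 + 2 * ν) = -(1 + 2 * ν) / 11 := by
  have h : (1 + 2 * ν) * (-(1 + 2 * ν) / 11) = 1 := by linear_combination (-4 / 11) * ν_sq
  rw [one_div]
  exact inv_eq_of_mul_eq_one_right h

theorem im_ξ_pow (k : ℕ) : (ξ ^ k).im = Real.sin (k * (2 * Real.pi / 11)) := by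
  rw [ξ, ← Complex.exp_nat_mul]
  have : (k : ℂ) * (2 * Real.pi * Complex.I / 11)
      = ((k * (2 * Real.pi / 11) : ℝ) : ℂ) * Complex.I := by
    push_cast
    ring
  rw [this, Complex.exp_ofReal_mul_I_im]

theorem im_gauss_period_pos : 0 < (ξ + ξ ^ 3 + ξ ^ 4 + ξ ^ 5 + ξ ^ 9).im := by
  have hπ := Real.pi_pos
  have h1 := im_ξ_pow 1
  rw [pow_one] at h1
  simp only [Complex.add_im, h1, im_ξ_pow]
  have e3 : Real.sin ((3 : ℕ) * (2 * Real.pi / 11)) = Real.sin (5 * Real.pi / 11) := by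
    rw [← Real.sin_pi_sub]; congr 1; push_cast; ring
  have e9 : Real.sin ((9 : ℕ) * (2 * Real.pi / 11)) = -Real.sin (4 * Real.pi / 11) := by
    rw [← Real.sin_sub_two_pi, ← Real.sin_neg]; congr 1; push_cast; ring
  rw [e3, e9]
  have p1 : 0 < Real.sin ((1 : ℕ) * (2 * Real.pi / 11)) :=
    Real.sin_pos_of_pos_of_lt_pi (by push_cast; linarith) (by push_cast; linarith)
  have p4 : 0 < Real.sin ((4 : ℕ) * (2 * Real.pi / 11)) :=
    Real.sin_pos_of_pos_of_lt_pi (by push_cast; linarith) (by push_cast; linarith)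
  have p5 : 0 < Real.sin ((5 : ℕ) * (2 * Real.pi / 11)) :=
    Real.sin_pos_of_pos_of_lt_pi (by push_cast; linarith) (by push_cast; linarith)
  have p45 : Real.sin (4 * Real.pi / 11) < Real.sin (5 * Real.pi / 11) :=
    Real.sin_lt_sin_of_lt_of_le_pi_div_two (by linarith) (by linarith) (by linarith)
  linarith

/-- The quadratic Gauss period of conductor 11, with the sign of the square root determined. -/
theorem ν_eq_gauss_period : ν = ξ + ξ ^ 3 + ξ ^ 4 + ξ ^ 5 + ξ ^ 9 := by
  set g := ξ + ξ ^ 3 + ξ ^ 4 + ξ ^ 5 + ξ ^ 9 with hg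
  have hg2 : g ^ 2 + g + 3 = 0 := by
    rw [hg]
    linear_combination (3 : ℂ) * geom_sum_ξ +
      (2 * ξ + 2 * ξ ^ 2 + 2 * ξ ^ 3 + ξ ^ 7) * ξ_pow_eleven
  have hprod : (g - ν) * (g + 1 + ν) = 0 := by linear_combination hg2 - ν_sq
  rcases mul_eq_zero.mp hprod with h | h
  · exact (sub_eq_zero.mp h).symm
  · have hpos : 0 < g.im := im_gauss_period_pos
    have him : g.im + ν.im = 0 := by simpa using congrArg Complex.im h
    rw [im_ν] at him
    have := Real.sqrt_nonneg 11
    linarith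

/-- The recurrence given by the minimal polynomial over `ℚ(ν)` of the conjugates of `ξ`. -/
theorem pow_five_eq_of_gauss_period {η : ℂ} (h : η ^ 11 = 1)
    (hsum : 1 + η + η ^ 2 + η ^ 3 + η ^ 4 + η ^ 5 + η ^ 6 + η ^ 7 + η ^ 8 + η ^ 9 + η ^ 10 = 0)
    (hν : ν = η + η ^ 3 + η ^ 4 + η ^ 5 + η ^ 9) :
    η ^ 5 = 1 + (1 + ν) * η - η ^ 2 + η ^ 3 + ν * η ^ 4 := by
  rw [hν]
  linear_combination (-1 : ℂ) * hsum - η ^ 2 * h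

theorem v_five : v 5 = v 0 + (1 + ν) • v 1 - v 2 + v 3 + ν • v 4 := by
  ext i
  have hv (k : ℕ) : v k i = (ξ ^ ![1, 9, 3, 4, 5] i) ^ k := by
    rw [v, ← pow_mul, mul_comm]
  simp only [Pi.add_apply, Pi.sub_apply, Pi.smul_apply, smul_eq_mul, hv, pow_zero, pow_one]
  have hred (n : ℕ) : ξ ^ n = ξ ^ (n % 11) := pow_eq_pow_mod n ξ_pow_eleven
  apply pow_five_eq_of_gauss_period
  · rw [← pow_mul, mul_comm, pow_mul, ξ_pow_eleven, one_pow]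
  · have := geom_sum_ξ
    simp only [← pow_mul]
    rw [hred (_ * 2), hred (_ * 3), hred (_ * 4), hred (_ * 5), hred (_ * 6), hred (_ * 7),
      hred (_ * 8), hred (_ * 9), hred (_ * 10)]
    fin_cases i <;> norm_num <;> linear_combination this
  · have := ν_eq_gauss_period
    simp only [← pow_mul]
    rw [hred (_ * 3), hred (_ * 4), hred (_ * 5), hred (_ * 9)]
    fin_cases i <;> norm_num <;> linear_combination this

/-- The ring `ℤ[ν]` as an abstract quadratic algebra. -/
abbrev QuadraticOrder : Type := QuadraticAlgebra ℤ (-3) (-1)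

/-- The embedding of `ℤ[ν]` in `ℂ`. -/
noncomputable def toComplex : QuadraticOrder →ₐ[ℤ] ℂ :=
  QuadraticAlgebra.lift ⟨ν, by
    simp only [zsmul_eq_mul]
    push_cast
    linear_combination ν_sq⟩

theorem toComplex_apply (z : QuadraticOrder) : toComplex z = z.re + z.im * ν := by
  simp [toComplex]

theorem mem_Zν_iff (z : ℂ) : z ∈ Zν ↔ ∃ p, toComplex p = z := by
  constructor
  · rintro ⟨a, b, rfl⟩
    exact ⟨⟨a, b⟩, toComplex_apply _⟩
  · rintro ⟨p, rfl⟩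
    exact ⟨p.re, p.im, toComplex_apply p⟩

theorem conj_toComplex (z : QuadraticOrder) : star (toComplex z) = toComplex (star z) := by
  rw [toComplex_apply, toComplex_apply, re_star, im_star, ← starRingEnd_apply, map_add, map_mul,
    conj_ν, map_intCast, map_intCast]
  push_cast
  ring

theorem im_two_div_sqrt_mul_toComplex (z : QuadraticOrder) :
    ((2 / (Real.sqrt 11 : ℂ)) * toComplex z).im = z.im := by
  have h : (2 / (Real.sqrt 11 : ℂ)) = ((2 / Real.sqrt 11 : ℝ) : ℂ) := by push_cast; rfl
  rw [h, Complex.im_ofReal_mul, toComplex_apply]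
  simp [im_ν]
  field_simp

theorem E_eq_dotProduct (x y : Fin 5 → ℂ) :
    E x y = ((2 / (Real.sqrt 11 : ℂ)) * (x ⬝ᵥ star y)).im := rfl

theorem v_dotProduct_star_v (j k : ℕ) :
    v j ⬝ᵥ star (v k) = ∑ i, ξ ^ ((j + 10 * k) * ![1, 9, 3, 4, 5] i % 11) := by
  refine Finset.sum_congr rfl fun i _ => ?_
  rw [← pow_eq_pow_mod _ ξ_pow_eleven]
  simp only [v, Pi.star_apply, ← starRingEnd_apply, map_pow, conj_ξ]
  ring

/-- The Gram matrix of the Hermitian form on the `ℤ[ν]`-basis of `Λ₂`. -/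
def periodGram : Matrix (Fin 5) (Fin 5) QuadraticOrder :=
  !![⟨10, 0⟩, ⟨-9, -3⟩, ⟨-4, -1⟩, ⟨3, 3⟩, ⟨0, -3⟩;
    ⟨-6, 3⟩, ⟨10, 0⟩, ⟨3, 0⟩, ⟨-4, -1⟩, ⟨3, 3⟩;
    ⟨-3, 1⟩, ⟨3, 0⟩, ⟨5, 0⟩, ⟨-1, -1⟩, ⟨0, 1⟩;
    ⟨0, -3⟩, ⟨-3, 1⟩, ⟨0, 1⟩, ⟨5, 0⟩, ⟨-1, -1⟩;
    ⟨3, 3⟩, ⟨0, -3⟩, ⟨-1, -1⟩, ⟨0, 1⟩, ⟨5, 0⟩]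

/-- The values of the Gauss periods `∑ i, ξ ^ (n * a i)` for the squares `a i` modulo 11. -/
noncomputable def periodValue (n : ℕ) : ℂ :=
  if n % 11 = 0 then 5 else if n % 11 ∈ [1, 3, 4, 5, 9] then ν else -1 - ν

theorem v_dotProduct_star_v_eq_periodValue (j k : ℕ) :
    v j ⬝ᵥ star (v k) = periodValue (j + 10 * k) := by
  have hg := geom_sum_ξ
  have hν := ν_eq_gauss_period
  rw [v_dotProduct_star_v, periodValue]
  have hn : (j + 10 * k) % 11 < 11 := Nat.mod_lt _ (by norm_num)
  simp only [Nat.mul_mod (j + 10 * k)]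
  generalize (j + 10 * k) % 11 = n at hn
  interval_cases n <;> simp [Fin.sum_univ_five] <;>
    first | linear_combination -hν | linear_combination hν + hg

theorem periodBasis_dotProduct_star (i j : Fin 5) :
    periodBasis i ⬝ᵥ star (periodBasis j) = toComplex (periodGram i j) := by
  have hν := ν_sq
  fin_cases i <;> fin_cases j <;>
    simp [periodBasis, u₁, u₂, -one_div, one_div_one_add_two_mul_ν, conj_ν, add_dotProduct,
      sub_dotProduct, dotProduct_add, dotProduct_sub, v_dotProduct_star_v_eq_periodValue,
      periodValue, periodGram, toComplex_apply] <;>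
    grind

theorem sum_smul_dotProduct_star (p q : Fin 5 → QuadraticOrder) :
    (∑ j, toComplex (p j) • periodBasis j) ⬝ᵥ star (∑ k, toComplex (q k) • periodBasis k)
      = toComplex (∑ j, ∑ k, p j * star (q k) * periodGram j k) := by
  simp only [star_sum, star_smul, sum_dotProduct, dotProduct_sum, smul_dotProduct,
    dotProduct_smul, periodBasis_dotProduct_star, conj_toComplex, smul_eq_mul, map_sum, map_mul]
  simp only [Finset.mul_sum]
  rw [Finset.sum_comm]
  exact Finset.sum_congr rfl fun j _ => Finset.sum_congr rfl fun k _ => by ring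

theorem mem_Λ₂_iff (x : Fin 5 → ℂ) :
    x ∈ Λ₂ ↔ ∃ p : Fin 5 → QuadraticOrder, x = ∑ j, toComplex (p j) • periodBasis j := by
  constructor
  · rintro ⟨c, hc, rfl⟩
    choose p hp using fun j => (mem_Zν_iff (c j)).mp (hc j)
    exact ⟨p, by simp only [hp]⟩
  · rintro ⟨p, rfl⟩
    exact ⟨_, fun j => (mem_Zν_iff _).mpr ⟨p j, rfl⟩, rfl⟩

theorem E_integral {x y : Fin 5 → ℂ} (hx : x ∈ Λ₂) (hy : y ∈ Λ₂) : ∃ n : ℤ, E x y = n := by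
  obtain ⟨p, rfl⟩ := (mem_Λ₂_iff x).mp hx
  obtain ⟨q, rfl⟩ := (mem_Λ₂_iff y).mp hy
  rw [E_eq_dotProduct, sum_smul_dotProduct_star, im_two_div_sqrt_mul_toComplex]
  exact ⟨_, rfl⟩

/-- The coefficient in `{1, ν}` of a member of the real basis of `Λ₂`. -/
def tenCoeff : Fin 10 → QuadraticOrder :=
  ![1, ⟨0, 1⟩, 1, ⟨0, 1⟩, 1, ⟨0, 1⟩, 1, ⟨0, 1⟩, 1, ⟨0, 1⟩]

/-- The index in the `ℤ[ν]`-basis of a member of the real basis of `Λ₂`. -/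
def tenIndex : Fin 10 → Fin 5 := ![0, 0, 1, 1, 2, 2, 3, 3, 4, 4]

theorem tenBasis_eq_smul (i : Fin 10) :
    tenBasis i = toComplex (tenCoeff i) • periodBasis (tenIndex i) := by
  fin_cases i <;> simp [tenBasis, tenCoeff, tenIndex, periodBasis, toComplex_apply]

/-- The integer matrix of the form `E` on the real basis of `Λ₂`. -/
def riemannMatrix : Matrix (Fin 10) (Fin 10) ℤ :=
  Matrix.of fun i j => (tenCoeff i * star (tenCoeff j) * periodGram (tenIndex i) (tenIndex j)).im

theorem E_tenBasis (i j : Fin 10) : E (tenBasis i) (tenBasis j) = riemannMatrix i j := by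
  rw [E_eq_dotProduct, tenBasis_eq_smul, tenBasis_eq_smul, star_smul, smul_dotProduct,
    dotProduct_smul, periodBasis_dotProduct_star, conj_toComplex, smul_eq_mul, smul_eq_mul,
    ← map_mul, ← map_mul, im_two_div_sqrt_mul_toComplex, ← mul_assoc]
  rfl

/-- Left factor reducing the matrix of `E` to triangular form. -/
def leftReduction : Matrix (Fin 10) (Fin 10) ℤ :=
  !![1, 0, 0, 0, 0, 0, 0, 0, 0, 0;
    1, 1, 0, 0, 0, 0, 0, 0, 0, 0;
    6, -3, 10, 0, 0, 0, 0, 0, 0, 0;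
    15, 6, 10, 10, 0, 0, 0, 0, 0, 0;
    12, -1, 6, 3, 19, 0, 0, 0, 0, 0;
    15, 12, -3, 6, 19, 19, 0, 0, 0, 0;
    24, 41, 6, 25, -9, 2, 62, 0, 0, 0;
    -99, 24, -69, 6, -15, -9, 62, 62, 0, 0;
    -30, -79, 3, -23, 35, -5, -98, -4, 79, 0;
    207, -30, 72, 3, 50, 35, -86, -98, 79, 79]

/-- Right factor reducing the matrix of `E` to triangular form: it adds each odd column to the
preceding one. -/
def rightReduction : Matrix (Fin 10) (Fin 10) ℤ :=
  Matrix.of fun i j => if i = j ∨ (i.val % 2 = 1 ∧ i.val = j.val + 1) then 1 else 0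

theorem det_riemannMatrix : riemannMatrix.det = 1 := by
  have tL : ∀ j i, i < j → leftReduction i j = 0 := by decide +kernel
  have tR : ∀ j i, i < j → rightReduction i j = 0 := by decide +kernel
  have tU : ∀ i j, j < i → (leftReduction * riemannMatrix * rightReduction) i j = 0 := by
    decide +kernel
  have hL : leftReduction.det = 866053584400 := by
    rw [det_of_isLowerTriangular _ fun i j h => tL j i h]
    decide +kernel
  have hR : rightReduction.det = 1 := by
    rw [det_of_isLowerTriangular _ fun i j h => tR j i h]
    decide +kernel
  have hU : (leftReduction * riemannMatrix * rightReduction).det = 866053584400 := by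
    rw [det_of_isUpperTriangular fun i j h => tU i j h]
    decide +kernel
  rw [det_mul, det_mul, hL, hR] at hU
  linarith

theorem det_E_tenBasis :
    (Matrix.of fun i j : Fin 10 => E (tenBasis i) (tenBasis j)).det = 1 := by
  have h : (Matrix.of fun i j : Fin 10 => E (tenBasis i) (tenBasis j))
      = riemannMatrix.map (Int.castRingHom ℝ) := by
    ext i j
    simp [E_tenBasis]
  rw [h, ← RingHom.mapMatrix_apply, ← RingHom.map_det, det_riemannMatrix, map_one]

theorem E_sum_smul_left {ι : Type*} [Fintype ι] (g : ι → ℝ) (b : ι → Fin 5 → ℂ)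
    (y : Fin 5 → ℂ) : E (∑ i, g i • b i) y = ∑ i, g i * E (b i) y := by
  simp only [E_eq_dotProduct, sum_dotProduct, smul_dotProduct, Finset.mul_sum, Complex.im_sum,
    mul_smul_comm, Complex.smul_im, smul_eq_mul]

theorem linearIndependent_tenBasis : LinearIndependent ℝ tenBasis := by
  rw [Fintype.linearIndependent_iff]
  intro g hg
  refine congrFun (eq_zero_of_vecMul_eq_zero
    (M := Matrix.of fun i j : Fin 10 => E (tenBasis i) (tenBasis j)) ?_ ?_)
  · rw [det_E_tenBasis]
    exact one_ne_zero
  · ext j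
    have h := E_sum_smul_left g tenBasis (tenBasis j)
    rw [hg] at h
    simpa [vecMul, dotProduct, E] using h.symm

/-- The diagonal map `M_τ`. -/
noncomputable def diagonalMap : (Fin 5 → ℂ) →ₗ[ℂ] (Fin 5 → ℂ) :=
  (diagonal ![ξ, ξ ^ 9, ξ ^ 3, ξ ^ 4, ξ ^ 5]).mulVecLin

theorem diagonalMap_apply (x : Fin 5 → ℂ) :
    diagonalMap x = fun i => ![ξ, ξ ^ 9, ξ ^ 3, ξ ^ 4, ξ ^ 5] i * x i := by
  ext i
  simp [diagonalMap, mulVec_diagonal]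

theorem diagonalMap_v (k : ℕ) : diagonalMap (v k) = v (k + 1) := by
  rw [diagonalMap_apply]
  ext i
  fin_cases i <;> simp [v] <;> ring

/-- The matrix of `M_τ` on the `ℤ[ν]`-basis of `Λ₂`. -/
def diagonalMapMatrix : Matrix (Fin 5) (Fin 5) QuadraticOrder :=
  !![0, 1, 0, 0, 0;
    ⟨-5, 3⟩, ⟨-3, 1⟩, ⟨-2, -1⟩, ⟨5, 3⟩, ⟨-4, -2⟩;
    0, 0, 0, 1, 0;
    0, 0, 0, 0, 1;
    ⟨-1, -2⟩, 0, 1, ⟨-3, 0⟩, ⟨3, 0⟩]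

theorem diagonalMap_periodBasis (j : Fin 5) :
    diagonalMap (periodBasis j) = ∑ k, toComplex (diagonalMapMatrix j k) • periodBasis k := by
  have hν := ν_sq
  ext i
  have h5 := congrFun v_five i
  simp only [Pi.add_apply, Pi.sub_apply, Pi.smul_apply, smul_eq_mul] at h5
  fin_cases j <;>
    simp [periodBasis, u₁, u₂, -one_div, one_div_one_add_two_mul_ν, diagonalMap_v,
      diagonalMapMatrix, Fin.sum_univ_five, toComplex_apply] <;>
    grind

theorem diagonalMap_mem_Λ₂ {x : Fin 5 → ℂ} (hx : x ∈ Λ₂) : diagonalMap x ∈ Λ₂ := by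
  obtain ⟨p, rfl⟩ := (mem_Λ₂_iff x).mp hx
  refine (mem_Λ₂_iff _).mpr ⟨p ᵥ* diagonalMapMatrix, ?_⟩
  simp only [map_sum, map_smul, diagonalMap_periodBasis, vecMul, dotProduct, map_mul,
    Finset.smul_sum, Finset.sum_smul, mul_smul]
  exact Finset.sum_comm

/-- (i) the ten vectors are ℝ-linearly independent, so Λ₂ is a full lattice in
ℂ⁵ ≅ ℝ¹⁰; (ii) E is integer valued on Λ₂ × Λ₂; (iii) the determinant of the 10×10 matrix of
values of E on this basis is 1; (iv) Λ₂ is stable under M_τ = diag(ξ, ξ⁹, ξ³, ξ⁴, ξ⁵). -/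
theorem period_lattice_principal_polarization :
    LinearIndependent ℝ tenBasis ∧
    (∀ x ∈ Λ₂, ∀ y ∈ Λ₂, ∃ n : ℤ, E x y = n) ∧
    (Matrix.of fun i j : Fin 10 => E (tenBasis i) (tenBasis j)).det = 1 ∧
    (∀ x ∈ Λ₂, (fun i => ![ξ, ξ ^ 9, ξ ^ 3, ξ ^ 4, ξ ^ 5] i * x i) ∈ Λ₂) := by
  refine ⟨linearIndependent_tenBasis, fun x hx y hy => E_integral hx hy, det_E_tenBasis,
    fun x hx => ?_⟩
  rw [← diagonalMap_apply]
  exact diagonalMap_mem_Λ₂ hx
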